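/- Bounds on the linearization coefficients at the maximum point (Corollary 2.14). Fix n ≥ 2, constants C_E ≥ 1 and C_S > 0, positive numbers r₀, r₁ with r₁ ≤ r₀ and 3r₀ ≤ 1, a point x₁ ∈ ℝⁿ with ‖x₁‖ = 2r₀, α > 0, and δ > 0 with δ ≤ r₀^{α+2}/α; set w(x) := ‖x‖^{−α} and C_H := 2( C_E²((n−1)(C_S + 1) + 2) + 1 ). Let U ⊆ ℝⁿ×ℝ×ℝⁿ be open with every fiber U_x convex and let M (given by a^{ij}, b) be uniformly elliptic on U with constant C_E. Let x_* ∈ B(x₁,r₁) and let φ₀, φ₁ be U-admissible C² functions on a neighborhood of x_* such that: (a) f := (φ₁ − φ₀) + δw has a local maximum at x_*; (b) D²φ₁(x_*) ≥ −C_S·I; (c) M[φ₀](x_*) ≤ C_E. Let B^i[φ₀,φ₁] and C[φ₀,φ₁] be the linearization coefficients B^i[φ₀,φ₁](x) := ∫₀¹ ( Σ_{j,k} (∂a^{jk}/∂p^i)(x,φ_t,Dφ_t) D_{jk}φ_t + (∂b/∂p^i)(x,φ_t,Dφ_t) ) dt and C[φ₀,φ₁](x) := ∫₀¹ ( Σ_{i,j}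 (∂a^{ij}/∂r)(x,φ_t,Dφ_t) D_{ij}φ_t + (∂b/∂r)(x,φ_t,Dφ_t) ) dt, where φ_t := (1−t)φ₀ + tφ₁. Then |B^i[φ₀,φ₁]|(x_*) ≤ n²C_E(C_H+1) for each i, |C[φ₀,φ₁]|(x_*) ≤ n²C_E(C_H+1), and ‖B[φ₀,φ₁]‖(x_*) := ( Σ_i (B^i[φ₀,φ₁](x_*))² )^{1/2} ≤ n³C_E(C_H+1). -/

import Mathlib

open scoped BigOperators

noncomputable section

abbrev Euc (n : ℕ) := EuclideanSpace ℝ (Fin n)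

def pd (n : ℕ) (i : Fin n) (u : Euc n → ℝ) (x : Euc n) : ℝ :=
  fderiv ℝ u x (EuclideanSpace.single i 1)

def pd2 (n : ℕ) (i j : Fin n) (u : Euc n → ℝ) (x : Euc n) : ℝ :=
  fderiv ℝ (fun y => fderiv ℝ u y (EuclideanSpace.single j 1)) x (EuclideanSpace.single i 1)

def hessM (n : ℕ) (u : Euc n → ℝ) (x : Euc n) : Matrix (Fin n) (Fin n) ℝ :=
  Matrix.of fun i j => pd2 n i j u x

def hessMax (n : ℕ) (u : Euc n → ℝ) (x : Euc n) : ℝ :=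
  ⨆ i : Fin n, ⨆ j : Fin n, |pd2 n i j u x|

def MEval (n : ℕ) (a : Euc n × ℝ × Euc n → Fin n → Fin n → ℝ)
    (b : Euc n × ℝ × Euc n → ℝ) (u : Euc n → ℝ) (x : Euc n) : ℝ :=
  (∑ i, ∑ j, a (x, u x, gradient u x) i j * pd2 n i j u x) + b (x, u x, gradient u x)

def da_r (n : ℕ) (a : Euc n × ℝ × Euc n → Fin n → Fin n → ℝ)
    (z : Euc n × ℝ × Euc n) (i j : Fin n) : ℝ :=
  fderiv ℝ (fun rp : ℝ × Euc n => a (z.1, rp.1, rp.2) i j) z.2 (1, 0)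

def da_p (n : ℕ) (a : Euc n × ℝ × Euc n → Fin n → Fin n → ℝ)
    (z : Euc n × ℝ × Euc n) (k i j : Fin n) : ℝ :=
  fderiv ℝ (fun rp : ℝ × Euc n => a (z.1, rp.1, rp.2) i j) z.2 (0, EuclideanSpace.single k 1)

def db_r (n : ℕ) (b : Euc n × ℝ × Euc n → ℝ) (z : Euc n × ℝ × Euc n) : ℝ :=
  fderiv ℝ (fun rp : ℝ × Euc n => b (z.1, rp.1, rp.2)) z.2 (1, 0)

def db_p (n : ℕ) (b : Euc n × ℝ × Euc n → ℝ) (z : Euc n × ℝ × Euc n) (k : Fin n) : ℝ :=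
  fderiv ℝ (fun rp : ℝ × Euc n => b (z.1, rp.1, rp.2)) z.2 (0, EuclideanSpace.single k 1)

def UniformlyElliptic (n : ℕ) (U : Set (Euc n × ℝ × Euc n))
    (a : Euc n × ℝ × Euc n → Fin n → Fin n → ℝ) (b : Euc n × ℝ × Euc n → ℝ)
    (CE : ℝ) : Prop :=
  (∀ z ∈ U, ∀ i j, a z i j = a z j i) ∧
  (∀ i j, ContinuousOn (fun z => a z i j) U) ∧
  ContinuousOn b U ∧
  (∀ x : Euc n, ∀ i j, ContDiffOn ℝ 1 (fun rp : ℝ × Euc n => a (x, rp.1, rp.2) i j)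
      {rp : ℝ × Euc n | (x, rp.1, rp.2) ∈ U}) ∧
  (∀ x : Euc n, ContDiffOn ℝ 1 (fun rp : ℝ × Euc n => b (x, rp.1, rp.2))
      {rp : ℝ × Euc n | (x, rp.1, rp.2) ∈ U}) ∧
  (∀ z ∈ U, ∀ ξ : Fin n → ℝ,
      (1 / CE) * (∑ i, ξ i ^ 2) ≤ ∑ i, ∑ j, a z i j * ξ i * ξ j ∧
      (∑ i, ∑ j, a z i j * ξ i * ξ j) ≤ CE * (∑ i, ξ i ^ 2)) ∧
  (∀ z ∈ U, ∀ i j k,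
      |da_p n a z k i j| ≤ CE ∧ |da_r n a z i j| ≤ CE ∧
      |db_p n b z k| ≤ CE ∧ |db_r n b z| ≤ CE ∧ |b z| ≤ CE)

def UAdmissibleOn (n : ℕ) (U : Set (Euc n × ℝ × Euc n)) (s : Set (Euc n))
    (u : Euc n → ℝ) : Prop :=
  ∀ x ∈ s, (x, u x, gradient u x) ∈ U

def MLeSupport (n : ℕ) (U : Set (Euc n × ℝ × Euc n))
    (a : Euc n × ℝ × Euc n → Fin n → Fin n → ℝ) (b : Euc n × ℝ × Euc n → ℝ)
    (Ω : Set (Euc n)) (u : Euc n → ℝ) (H₀ : ℝ) : Prop :=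
  ∀ ε > (0 : ℝ), ∀ x ∈ Ω, ∃ (φ : Euc n → ℝ) (N : Set (Euc n)),
    IsOpen N ∧ x ∈ N ∧ ContDiffOn ℝ 2 φ N ∧ UAdmissibleOn n U N φ ∧
    φ x = u x ∧ (∀ y ∈ N ∩ Ω, u y ≤ φ y) ∧ MEval n a b φ x ≤ H₀ + ε

def MGeSupportHess (n : ℕ) (U : Set (Euc n × ℝ × Euc n))
    (a : Euc n × ℝ × Euc n → Fin n → Fin n → ℝ) (b : Euc n × ℝ × Euc n → ℝ)
    (Ω : Set (Euc n)) (v : Euc n → ℝ) (H₀ : ℝ) : Prop :=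
  ∃ CS > (0 : ℝ), ∀ ε > (0 : ℝ), ∀ x ∈ Ω, ∃ (ψ : Euc n → ℝ) (N : Set (Euc n)),
    IsOpen N ∧ x ∈ N ∧ ContDiffOn ℝ 2 ψ N ∧ UAdmissibleOn n U N ψ ∧
    ψ x = v x ∧ (∀ y ∈ N ∩ Ω, ψ y ≤ v y) ∧ H₀ - ε ≤ MEval n a b ψ x ∧
    (hessM n ψ x + CS • (1 : Matrix (Fin n) (Fin n) ℝ)).PosSemidef


/-- The interpolation `φ_t = (1-t)φ₀ + tφ₁`. -/
def phit (n : ℕ) (φ₀ φ₁ : Euc n → ℝ) (t : ℝ) : Euc n → ℝ :=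
  fun x => (1 - t) * φ₀ x + t * φ₁ x

/-- Linearization coefficient `A^{ij}[φ₀,φ₁]`. -/
def Acoef (n : ℕ) (a : Euc n × ℝ × Euc n → Fin n → Fin n → ℝ)
    (φ₀ φ₁ : Euc n → ℝ) (i j : Fin n) (x : Euc n) : ℝ :=
  ∫ t in (0:ℝ)..1,
    a (x, phit n φ₀ φ₁ t x, gradient (phit n φ₀ φ₁ t) x) i j

/-- Linearization coefficient `B^i[φ₀,φ₁]`. -/
def Bcoef (n : ℕ) (a : Euc n × ℝ × Euc n → Fin n → Fin n → ℝ)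
    (b : Euc n × ℝ × Euc n → ℝ) (φ₀ φ₁ : Euc n → ℝ) (i : Fin n) (x : Euc n) : ℝ :=
  ∫ t in (0:ℝ)..1,
    ((∑ j, ∑ k, da_p n a (x, phit n φ₀ φ₁ t x, gradient (phit n φ₀ φ₁ t) x) i j k *
        pd2 n j k (phit n φ₀ φ₁ t) x) +
      db_p n b (x, phit n φ₀ φ₁ t x, gradient (phit n φ₀ φ₁ t) x) i)

/-- Linearization coefficient `C[φ₀,φ₁]`. -/
def Ccoef (n : ℕ) (a : Euc n × ℝ × Euc n → Fin n → Fin n → ℝ)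
    (b : Euc n × ℝ × Euc n → ℝ) (φ₀ φ₁ : Euc n → ℝ) (x : Euc n) : ℝ :=
  ∫ t in (0:ℝ)..1,
    ((∑ i, ∑ j, da_r n a (x, phit n φ₀ φ₁ t x, gradient (phit n φ₀ φ₁ t) x) i j *
        pd2 n i j (phit n φ₀ φ₁ t) x) +
      db_r n b (x, phit n φ₀ φ₁ t x, gradient (phit n φ₀ φ₁ t) x))

open Filter Topology in
/-- The second-order necessary condition at a local maximum of a function on the line. -/
lemma IsLocalMax.deriv_deriv_nonpos {g : ℝ → ℝ} {t : ℝ} (h : IsLocalMax g t)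
    (hc : ContinuousAt g t) : deriv (deriv g) t ≤ 0 := by
  by_contra! hpos
  have hmin := isLocalMin_of_deriv_deriv_pos hpos h.deriv_eq_zero hc
  have hconst : g =ᶠ[𝓝 t] fun _ => g t := by
    filter_upwards [h, hmin] with s hs hs' using le_antisymm hs hs'
  have hzero := hconst.deriv.deriv_eq
  simp only [deriv_const'] at hzero
  exact hpos.ne' hzero

open Filter Topology in
/-- First and second derivatives of a `C²` function along a line. -/
lemma ContDiffAt.hasDerivAt_line {E : Type*} [NormedAddCommGroup E] [NormedSpace ℝ E]
    {φ : E → ℝ} {x : E} (h : ContDiffAt ℝ 2 φ x) (v : E) :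
    (∀ᶠ t in 𝓝 (0 : ℝ), HasDerivAt (fun t : ℝ => φ (x + t • v)) (fderiv ℝ φ (x + t • v) v) t) ∧
      HasDerivAt (fun t : ℝ => fderiv ℝ φ (x + t • v) v) (fderiv ℝ (fderiv ℝ φ) x v v) 0 := by
  have hline : ∀ t : ℝ, HasDerivAt (fun t : ℝ => x + t • v) v t := fun t => by
    simpa using ((hasDerivAt_id t).smul_const v).const_add x
  have hx : x + (0 : ℝ) • v = x := by simp
  constructor
  · have hev : ∀ᶠ y in 𝓝 x, DifferentiableAt ℝ φ y :=
      (h.eventually (by simp)).mono fun y hy => hy.differentiableAt (by simp)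
    have ht : Tendsto (fun t : ℝ => x + t • v) (𝓝 0) (𝓝 x) := by
      simpa [hx] using (hline 0).continuousAt.tendsto
    filter_upwards [ht.eventually hev] with t hd
    exact hd.hasFDerivAt.comp_hasDerivAt t (hline t)
  · have hd : DifferentiableAt ℝ (fderiv ℝ φ) x :=
      (h.fderiv_right (m := 1) (by norm_num)).differentiableAt (by simp)
    have hd' : HasFDerivAt (fderiv ℝ φ) (fderiv ℝ (fderiv ℝ φ) x) (x + (0 : ℝ) • v) := by
      rw [hx]; exact hd.hasFDerivAt
    have hcomp : HasDerivAt (fun t : ℝ => fderiv ℝ φ (x + t • v)) (fderiv ℝ (fderiv ℝ φ) x v) 0 :=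
      hd'.comp_hasDerivAt 0 (hline 0)
    have happ : HasDerivAt (fun t : ℝ => fderiv ℝ φ (x + t • v) v)
        (fderiv ℝ (fderiv ℝ φ) x v v + fderiv ℝ φ (x + (0 : ℝ) • v) 0) 0 :=
      hcomp.clm_apply (hasDerivAt_const (0 : ℝ) v)
    simpa using happ

lemma pd2_eq_fderiv_fderiv {n : ℕ} {φ : Euc n → ℝ} {x : Euc n} (h : ContDiffAt ℝ 2 φ x)
    (i j : Fin n) : pd2 n i j φ x = fderiv ℝ (fderiv ℝ φ) x (EuclideanSpace.single i 1)
      (EuclideanSpace.single j 1) := by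
  have hd : DifferentiableAt ℝ (fderiv ℝ φ) x :=
    (h.fderiv_right (m := 1) (by norm_num)).differentiableAt (by simp)
  rw [pd2, fderiv_clm_apply hd (differentiableAt_const _)]
  simp

lemma pd2_comm {n : ℕ} {φ : Euc n → ℝ} {x : Euc n} (h : ContDiffAt ℝ 2 φ x)
    (i j : Fin n) : pd2 n i j φ x = pd2 n j i φ x := by
  rw [pd2_eq_fderiv_fderiv h, pd2_eq_fderiv_fderiv h]
  exact (h.isSymmSndFDerivAt (by simp)) _ _

lemma fderiv_fderiv_apply_self {n : ℕ} {φ : Euc n → ℝ} {x : Euc n} (h : ContDiffAt ℝ 2 φ x)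
    (v : Euc n) : fderiv ℝ (fderiv ℝ φ) x v v = ∑ i, ∑ j, pd2 n i j φ x * v i * v j := by
  have hv : v = ∑ i, v i • EuclideanSpace.single i (1 : ℝ) := by
    ext k
    simp [Finset.sum_apply, Pi.single_apply]
  conv_lhs => rw [hv]
  simp only [map_sum, map_smul, _root_.sum_apply, _root_.smul_apply,
    pd2_eq_fderiv_fderiv h, smul_eq_mul, Finset.mul_sum]
  rw [Finset.sum_comm]
  exact Finset.sum_congr rfl fun i _ => Finset.sum_congr rfl fun j _ => by ring

/-- The tangent-line bound for the convex function `s ↦ s ^ (-β)` at `1`. -/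
lemma one_sub_mul_le_rpow_neg {s β : ℝ} (hs : 0 < s) (hβ : 0 ≤ β) :
    1 - β * (s - 1) ≤ s ^ (-β) := by
  rw [Real.rpow_def_of_pos hs]
  have h₁ := Real.add_one_le_exp (Real.log s * -β)
  have h₂ := mul_le_mul_of_nonneg_left (Real.log_le_sub_one_of_pos hs) hβ
  linarith

/-- The radial power `‖y‖ ^ (-α)` lies above its tangent function in the variable `‖y‖ ^ 2`. -/
lemma norm_rpow_neg_tangent_le {E : Type*} [NormedAddCommGroup E] {x y : E} {α : ℝ} (hα : 0 ≤ α)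
    (hx : x ≠ 0) (hy : y ≠ 0) :
    ‖x‖ ^ (-α) - α / 2 * ‖x‖ ^ (-(α + 2)) * (‖y‖ ^ 2 - ‖x‖ ^ 2) ≤ ‖y‖ ^ (-α) := by
  have hx' := norm_pos_iff.2 hx
  have hy' := norm_pos_iff.2 hy
  have key := one_sub_mul_le_rpow_neg (s := (‖y‖ / ‖x‖) ^ 2) (β := α / 2) (by positivity)
    (by positivity)
  have e₁ : ((‖y‖ / ‖x‖) ^ 2) ^ (-(α / 2)) = ‖y‖ ^ (-α) / ‖x‖ ^ (-α) := by
    rw [← Real.rpow_natCast, ← Real.rpow_mul (by positivity), ← Real.div_rpow hy'.le hx'.le]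
    congr 1
    push_cast
    ring
  have e₂ : ‖x‖ ^ (-(α + 2)) = ‖x‖ ^ (-α) / ‖x‖ ^ 2 := by
    rw [neg_add, ← sub_eq_add_neg, Real.rpow_sub hx']
    norm_num
  have hp : 0 < ‖x‖ ^ (-α) := Real.rpow_pos_of_pos hx' _
  rw [e₁, le_div_iff₀ hp] at key
  rw [e₂]
  have hne := hx'.ne'
  refine le_of_eq_of_le ?_ key
  field_simp

lemma Matrix.PosSemidef.quadraticForm_nonneg {ι : Type*} [Fintype ι] {K : Matrix ι ι ℝ}
    (hK : K.PosSemidef) (ξ : ι → ℝ) : 0 ≤ ∑ i, ∑ j, K i j * ξ i * ξ j := by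
  have h := hK.dotProduct_mulVec_nonneg ξ
  simp only [dotProduct, Matrix.mulVec, star_trivial, Finset.mul_sum] at h
  refine h.trans_eq ?_
  exact Finset.sum_congr rfl fun i _ => Finset.sum_congr rfl fun j _ => by ring

lemma Matrix.PosSemidef.abs_apply_le {ι : Type*} [Fintype ι] [DecidableEq ι] {K : Matrix ι ι ℝ}
    (hK : K.PosSemidef) {T : ℝ} (hT : ∀ i, K i i ≤ T) (i j : ι) : |K i j| ≤ T := by
  have hsymm : K j i = K i j := by simpa using hK.isHermitian.apply i j
  by_cases hij : i = j
  · subst hij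
    rw [abs_of_nonneg hK.diag_nonneg]
    exact hT i
  have key : ∀ s : ℝ, 0 ≤ K i i + 2 * s * K i j + s ^ 2 * K j j := by
    intro s
    have h := hK.quadraticForm_nonneg (Pi.single i 1 + Pi.single j s)
    simp only [Pi.add_apply, mul_add, add_mul, Finset.sum_add_distrib, Pi.single_apply, mul_ite,
      ite_mul, mul_zero, zero_mul, Finset.sum_ite_eq', Finset.mem_univ, if_true, mul_one] at h
    simp [hsymm] at h
    linarith
  have h₁ := key 1
  have h₂ := key (-1)
  rw [abs_le]
  constructor <;> linarith [hT i, hT j]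

open scoped MatrixOrder Matrix.Norms.L2Operator in
/-- A lower ellipticity bound on `A` controls the trace of a positive semidefinite `K` by `A : K`. -/
lemma Matrix.PosSemidef.mul_trace_le {ι : Type*} [Fintype ι] [DecidableEq ι] {K : Matrix ι ι ℝ}
    (hK : K.PosSemidef) {A : ι → ι → ℝ} {c : ℝ}
    (hA : ∀ ξ : ι → ℝ, c * (∑ i, ξ i ^ 2) ≤ ∑ i, ∑ j, A i j * ξ i * ξ j) :
    c * ∑ i, K i i ≤ ∑ i, ∑ j, A i j * K i j := by
  obtain ⟨B, hB⟩ := CStarAlgebra.nonneg_iff_eq_star_mul_self.mp hK.nonneg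
  have hK' : ∀ i j, K i j = ∑ k, B k i * B k j := fun i j => by
    rw [hB, Matrix.mul_apply]
    simp [Matrix.star_apply]
  calc c * ∑ i, K i i = ∑ k, c * ∑ i, B k i ^ 2 := by
        simp only [hK', Finset.mul_sum]
        rw [Finset.sum_comm]
        simp only [sq]
    _ ≤ ∑ k, ∑ i, ∑ j, A i j * B k i * B k j := Finset.sum_le_sum fun k _ => hA (B k)
    _ = ∑ i, ∑ j, A i j * K i j := by
        simp only [hK', Finset.mul_sum]
        rw [Finset.sum_comm]
        refine Finset.sum_congr rfl fun i _ => ?_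
        rw [Finset.sum_comm]
        exact Finset.sum_congr rfl fun j _ => Finset.sum_congr rfl fun k _ => by ring

open Filter Topology in
/-- The Hessian comparison at a local maximum of `φ₁ - φ₀ + δ ‖·‖ ^ (-α)`. -/
lemma hessian_quadraticForm_le_of_isLocalMax {n : ℕ} {φ₀ φ₁ : Euc n → ℝ} {x : Euc n} {α δ : ℝ}
    (h₀ : ContDiffAt ℝ 2 φ₀ x) (h₁ : ContDiffAt ℝ 2 φ₁ x) (hα : 0 ≤ α) (hδ : 0 ≤ δ) (hx : x ≠ 0)
    (hmax : IsLocalMax (fun y => (φ₁ y - φ₀ y) + δ * ‖y‖ ^ (-α)) x) (v : Euc n) :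
    ∑ i, ∑ j, pd2 n i j φ₁ x * v i * v j ≤ (∑ i, ∑ j, pd2 n i j φ₀ x * v i * v j) +
      δ * α * ‖x‖ ^ (-(α + 2)) * ‖v‖ ^ 2 := by
  set c := δ * (α / 2 * ‖x‖ ^ (-(α + 2))) with hc
  have hsq : ∀ t : ℝ, ‖x + t • v‖ ^ 2 - ‖x‖ ^ 2 = 2 * t * inner ℝ x v + t ^ 2 * ‖v‖ ^ 2 := by
    intro t
    rw [norm_add_sq_real, inner_smul_right, norm_smul, mul_pow, Real.norm_eq_abs, sq_abs]
    ring
  have hline : Tendsto (fun t : ℝ => x + t • v) (𝓝 0) (𝓝 x) := by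
    have : Continuous fun t : ℝ => x + t • v := by fun_prop
    simpa using this.tendsto 0
  obtain ⟨hd₀, hdd₀⟩ := h₀.hasDerivAt_line v
  obtain ⟨hd₁, hdd₁⟩ := h₁.hasDerivAt_line v
  set g : ℝ → ℝ := fun t => φ₁ (x + t • v) - φ₀ (x + t • v) -
    c * (2 * t * inner ℝ x v + t ^ 2 * ‖v‖ ^ 2) with hg
  have hpoly : ∀ t : ℝ, HasDerivAt (fun t : ℝ => c * (2 * t * inner ℝ x v + t ^ 2 * ‖v‖ ^ 2))
      (c * (2 * inner ℝ x v + 2 * t * ‖v‖ ^ 2)) t := fun t => by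
    have e₁ : HasDerivAt (fun t : ℝ => 2 * t * inner ℝ x v) (2 * inner ℝ x v) t := by
      simpa using ((hasDerivAt_id t).const_mul (2 : ℝ)).mul_const (inner ℝ x v)
    have e₂ : HasDerivAt (fun t : ℝ => t ^ 2 * ‖v‖ ^ 2) (2 * t * ‖v‖ ^ 2) t := by
      simpa using (hasDerivAt_pow 2 t).mul_const (‖v‖ ^ 2)
    exact (e₁.add e₂).const_mul c
  have hgd : ∀ᶠ t in 𝓝 (0 : ℝ), HasDerivAt g (fderiv ℝ φ₁ (x + t • v) v -
      fderiv ℝ φ₀ (x + t • v) v - c * (2 * inner ℝ x v + 2 * t * ‖v‖ ^ 2)) t := by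
    filter_upwards [hd₀, hd₁] with t ht₀ ht₁ using (ht₁.sub ht₀).sub (hpoly t)
  have hgdd : deriv (deriv g) 0 = fderiv ℝ (fderiv ℝ φ₁) x v v - fderiv ℝ (fderiv ℝ φ₀) x v v -
      c * (2 * ‖v‖ ^ 2) := by
    have heq : deriv g =ᶠ[𝓝 0] fun t => fderiv ℝ φ₁ (x + t • v) v -
        fderiv ℝ φ₀ (x + t • v) v - c * (2 * inner ℝ x v + 2 * t * ‖v‖ ^ 2) :=
      hgd.mono fun t ht => ht.deriv
    have hlin : HasDerivAt (fun t : ℝ => c * (2 * inner ℝ x v + 2 * t * ‖v‖ ^ 2))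
        (c * (2 * ‖v‖ ^ 2)) 0 := by
      simpa using ((((hasDerivAt_id (0 : ℝ)).const_mul (2 : ℝ)).mul_const (‖v‖ ^ 2)).const_add
        (2 * inner ℝ x v)).const_mul c
    rw [heq.deriv_eq]
    exact ((hdd₁.sub hdd₀).sub hlin).deriv
  have hgmax : IsLocalMax g 0 := by
    filter_upwards [hline.eventually hmax, hline.eventually (isOpen_ne.mem_nhds hx)] with t ht hne
    have htan := mul_le_mul_of_nonneg_left (norm_rpow_neg_tangent_le hα hx hne) hδ
    rw [hsq t] at htan
    have hval : g 0 = φ₁ x - φ₀ x := by simp [hg]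
    rw [hval]
    simp only [hg, hc]
    linarith
  have hfin := hgmax.deriv_deriv_nonpos hgd.self_of_nhds.continuousAt
  rw [hgdd, fderiv_fderiv_apply_self h₀, fderiv_fderiv_apply_self h₁] at hfin
  rw [hc] at hfin
  linarith

/-- If `D²φ₁ ≥ -CS` and `D²φ₁ ≤ D²φ₀ + 1` while `A : D²φ₀ ≤ 2 CE` for a uniformly elliptic `A`,
then all entries of both Hessians are bounded. -/
lemma abs_entry_le_of_elliptic {ι : Type*} [Fintype ι] [DecidableEq ι] {H₀ H₁ : Matrix ι ι ℝ}
    {A : ι → ι → ℝ} {CE CS T : ℝ} (hCE : 1 ≤ CE) (hCS : 0 ≤ CS)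
    (hA : ∀ ξ : ι → ℝ, (1 / CE) * (∑ i, ξ i ^ 2) ≤ ∑ i, ∑ j, A i j * ξ i * ξ j ∧
      (∑ i, ∑ j, A i j * ξ i * ξ j) ≤ CE * (∑ i, ξ i ^ 2))
    (hsymm : H₀.IsHermitian) (h₁ : (H₁ + CS • (1 : Matrix ι ι ℝ)).PosSemidef)
    (hle : ∀ ξ : ι → ℝ, ∑ i, ∑ j, H₁ i j * ξ i * ξ j ≤
      (∑ i, ∑ j, H₀ i j * ξ i * ξ j) + ∑ i, ξ i ^ 2)
    (htr : ∑ i, ∑ j, A i j * H₀ i j ≤ 2 * CE)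
    (hT : CE ^ 2 * (2 + Fintype.card ι * (CS + 1)) ≤ T) (hcard : 1 ≤ Fintype.card ι) (i j : ι) :
    |H₀ i j| ≤ T ∧ |H₁ i j| ≤ T := by
  have hshift : ∀ (H : Matrix ι ι ℝ) (s : ℝ) (ξ : ι → ℝ),
      ∑ i, ∑ j, (H + s • (1 : Matrix ι ι ℝ)) i j * ξ i * ξ j =
        (∑ i, ∑ j, H i j * ξ i * ξ j) + s * ∑ i, ξ i ^ 2 := by
    intro H s ξ
    simp only [Matrix.add_apply, Matrix.smul_apply, Matrix.one_apply, smul_eq_mul, add_mul,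
      Finset.sum_add_distrib, mul_ite, ite_mul, mul_one, mul_zero, zero_mul, Finset.sum_ite_eq,
      Finset.mem_univ, if_true, Finset.mul_sum, sq, mul_assoc]
  set K₀ := H₀ + (CS + 1) • (1 : Matrix ι ι ℝ) with hK₀
  have hK₀pos : K₀.PosSemidef := by
    refine .of_dotProduct_mulVec_nonneg (hsymm.add (Matrix.isHermitian_one.smul
      (IsSelfAdjoint.all _))) fun ξ => ?_
    have h := h₁.quadraticForm_nonneg ξ
    rw [hshift] at h
    have h' : 0 ≤ ∑ i, ∑ j, K₀ i j * ξ i * ξ j := by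
      rw [hK₀, hshift]
      linarith [hle ξ]
    refine h'.trans_eq ?_
    simp only [dotProduct, Matrix.mulVec, star_trivial, Finset.mul_sum]
    exact Finset.sum_congr rfl fun i _ => Finset.sum_congr rfl fun j _ => by ring
  have hdiagA : ∀ i, A i i ≤ CE := fun i => by
    have h := (hA (Pi.single i 1)).2
    simpa [Pi.single_apply] using h
  have htrace : ∑ i, K₀ i i ≤ CE ^ 2 * (2 + Fintype.card ι * (CS + 1)) := by
    have h := hK₀pos.mul_trace_le fun ξ => (hA ξ).1
    have hsplit : ∑ i, ∑ j, A i j * K₀ i j =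
        (∑ i, ∑ j, A i j * H₀ i j) + (CS + 1) * ∑ i, A i i := by
      simp only [hK₀, Matrix.add_apply, Matrix.smul_apply, Matrix.one_apply, smul_eq_mul, mul_add,
        Finset.sum_add_distrib, mul_ite, mul_one, mul_zero, Finset.sum_ite_eq, Finset.mem_univ,
        if_true, Finset.mul_sum]
      rw [Finset.sum_congr rfl fun i _ => (mul_comm (CS + 1) (A i i))]
      simp only [mul_add, mul_one, Finset.sum_add_distrib]
    have htrA : ∑ i, A i i ≤ Fintype.card ι * CE := by
      simpa using Finset.sum_le_sum fun i (_ : i ∈ Finset.univ) => hdiagA i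
    have hCE' : 0 < CE := by linarith
    rw [hsplit, one_div, inv_mul_le_iff₀ hCE'] at h
    have h₂ := mul_le_mul_of_nonneg_left htrA (by linarith : 0 ≤ CS + 1)
    calc ∑ i, K₀ i i ≤ CE * (2 * CE + (CS + 1) * (Fintype.card ι * CE)) :=
          h.trans (by gcongr)
      _ = _ := by ring
  have hdiag₀ : ∀ i, K₀ i i ≤ T := fun i =>
    (Finset.single_le_sum (f := fun i => K₀ i i) (fun i _ => hK₀pos.diag_nonneg)
      (Finset.mem_univ i)).trans (htrace.trans hT)
  have hdiag₁ : ∀ i, (H₁ + CS • (1 : Matrix ι ι ℝ)) i i ≤ T := fun i => by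
    have h := hle (Pi.single i 1)
    simp [Pi.single_apply] at h
    have h' := hdiag₀ i
    simp [hK₀] at h'
    simp
    linarith
  have hCST : CS + 1 ≤ T := by
    have hc : (1 : ℝ) ≤ Fintype.card ι := by exact_mod_cast hcard
    have h₂ : CS + 1 ≤ Fintype.card ι * (CS + 1) := by nlinarith
    have h₃ : (1 : ℝ) ≤ CE ^ 2 := by nlinarith
    nlinarith
  have hb₀ := hK₀pos.abs_apply_le hdiag₀ i j
  have hb₁ := h₁.abs_apply_le hdiag₁ i j
  by_cases hij : i = j
  · subst hij
    have hn₀ : 0 ≤ K₀ i i := hK₀pos.diag_nonneg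
    have hn₁ : 0 ≤ (H₁ + CS • (1 : Matrix ι ι ℝ)) i i := h₁.diag_nonneg
    have hd₀ := hdiag₀ i
    have hd₁ := hdiag₁ i
    simp [hK₀] at hn₀ hn₁ hd₀ hd₁
    constructor <;> rw [abs_le] <;> constructor <;> linarith
  · simpa [hK₀, Matrix.one_apply, hij] using And.intro hb₀ hb₁

lemma gradient_phit {n : ℕ} {φ₀ φ₁ : Euc n → ℝ} {x : Euc n}
    (h₀ : DifferentiableAt ℝ φ₀ x) (h₁ : DifferentiableAt ℝ φ₁ x) (t : ℝ) :
    gradient (phit n φ₀ φ₁ t) x = (1 - t) • gradient φ₀ x + t • gradient φ₁ x := by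
  have h := ((h₀.hasFDerivAt.const_mul (1 - t)).add (h₁.hasFDerivAt.const_mul t)).fderiv
  have h' : fderiv ℝ (phit n φ₀ φ₁ t) x = (1 - t) • fderiv ℝ φ₀ x + t • fderiv ℝ φ₁ x := h
  simp [gradient, h']

lemma pd2_phit {n : ℕ} {φ₀ φ₁ : Euc n → ℝ} {x : Euc n}
    (h₀ : ContDiffAt ℝ 2 φ₀ x) (h₁ : ContDiffAt ℝ 2 φ₁ x) (t : ℝ) (i j : Fin n) :
    pd2 n i j (phit n φ₀ φ₁ t) x = (1 - t) * pd2 n i j φ₀ x + t * pd2 n i j φ₁ x := by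
  have hφ : ContDiffAt ℝ 2 (phit n φ₀ φ₁ t) x :=
    (contDiffAt_const.mul h₀).add (contDiffAt_const.mul h₁)
  have hev : fderiv ℝ (phit n φ₀ φ₁ t) =ᶠ[nhds x]
      fun y => (1 - t) • fderiv ℝ φ₀ y + t • fderiv ℝ φ₁ y := by
    filter_upwards [h₀.eventually (by simp), h₁.eventually (by simp)] with y hy₀ hy₁
    exact (((hy₀.differentiableAt (by simp)).hasFDerivAt.const_mul (1 - t)).add
      ((hy₁.differentiableAt (by simp)).hasFDerivAt.const_mul t)).fderiv
  have hd₀ : DifferentiableAt ℝ (fderiv ℝ φ₀) x :=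
    (h₀.fderiv_right (m := 1) (by norm_num)).differentiableAt (by simp)
  have hd₁ : DifferentiableAt ℝ (fderiv ℝ φ₁) x :=
    (h₁.fderiv_right (m := 1) (by norm_num)).differentiableAt (by simp)
  have hder : fderiv ℝ (fderiv ℝ (phit n φ₀ φ₁ t)) x =
      (1 - t) • fderiv ℝ (fderiv ℝ φ₀) x + t • fderiv ℝ (fderiv ℝ φ₁) x := by
    rw [hev.fderiv_eq]
    exact ((hd₀.hasFDerivAt.const_smul (1 - t)).add (hd₁.hasFDerivAt.const_smul t)).fderiv
  rw [pd2_eq_fderiv_fderiv hφ, pd2_eq_fderiv_fderiv h₀, pd2_eq_fderiv_fderiv h₁, hder]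
  simp

/-- Bound for an integral over `[0, 1]` of a contraction of two bounded arrays plus a bounded
term. -/
lemma abs_integral_contraction_le {n : ℕ} (hn : 1 ≤ n) {P H : ℝ → Fin n → Fin n → ℝ} {q : ℝ → ℝ}
    {c T : ℝ} (hc : 0 ≤ c) (hP : ∀ t ∈ Set.Icc (0 : ℝ) 1, ∀ j k, |P t j k| ≤ c)
    (hH : ∀ t ∈ Set.Icc (0 : ℝ) 1, ∀ j k, |H t j k| ≤ T)
    (hq : ∀ t ∈ Set.Icc (0 : ℝ) 1, |q t| ≤ c) :
    |∫ t in (0 : ℝ)..1, ((∑ j, ∑ k, P t j k * H t j k) + q t)| ≤ (n : ℝ) ^ 2 * c * (T + 1) := by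
  have hbound := intervalIntegral.norm_integral_le_of_norm_le_const (a := (0 : ℝ)) (b := 1)
    (f := fun t => (∑ j, ∑ k, P t j k * H t j k) + q t) (C := (n : ℝ) ^ 2 * c * (T + 1)) ?_
  · simpa using hbound
  intro t ht
  rw [Set.uIoc_of_le zero_le_one] at ht
  have ht' : t ∈ Set.Icc (0 : ℝ) 1 := Set.Ioc_subset_Icc_self ht
  have hsum : |∑ j, ∑ k, P t j k * H t j k| ≤ (n : ℝ) ^ 2 * (c * T) := by
    calc |∑ j, ∑ k, P t j k * H t j k| ≤ ∑ j : Fin n, ∑ k : Fin n, c * T := by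
          refine (Finset.abs_sum_le_sum_abs _ _).trans (Finset.sum_le_sum fun j _ => ?_)
          refine (Finset.abs_sum_le_sum_abs _ _).trans (Finset.sum_le_sum fun k _ => ?_)
          rw [abs_mul]
          exact mul_le_mul (hP t ht' j k) (hH t ht' j k) (abs_nonneg _) hc
      _ = (n : ℝ) ^ 2 * (c * T) := by
          simp
          ring
  have hn' : (1 : ℝ) ≤ (n : ℝ) ^ 2 := one_le_pow₀ (by exact_mod_cast hn)
  rw [Real.norm_eq_abs]
  have hadd := abs_add_le (∑ j, ∑ k, P t j k * H t j k) (q t)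
  have hq' := hq t ht'
  have hcn : c ≤ (n : ℝ) ^ 2 * c := le_mul_of_one_le_left hc hn'
  linarith

/-- Corollary 2.14: bounds on the linearization coefficients at the maximum point. -/
theorem linearization_coefficient_bounds_at_max
    (n : ℕ) (hn : 2 ≤ n) (CE CS : ℝ) (hCE : 1 ≤ CE) (hCS : 0 < CS)
    (r₀ r₁ : ℝ) (hr₀ : 0 < r₀) (hr₁ : 0 < r₁) (hr₁r₀ : r₁ ≤ r₀) (h3r₀ : 3 * r₀ ≤ 1)
    (x₁ : Euc n) (hx₁ : ‖x₁‖ = 2 * r₀)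
    (α δ : ℝ) (hα : 0 < α) (hδ : 0 < δ) (hδα : δ ≤ r₀ ^ (α + 2) / α)
    (w : Euc n → ℝ) (hw : ∀ x, w x = ‖x‖ ^ (-α))
    (CH : ℝ) (hCH : CH = 2 * (CE ^ 2 * (((n : ℝ) - 1) * (CS + 1) + 2) + 1))
    (U : Set (Euc n × ℝ × Euc n)) (hUopen : IsOpen U)
    (hfiber : ∀ x : Euc n, Convex ℝ {rp : ℝ × Euc n | (x, rp.1, rp.2) ∈ U})
    (a : Euc n × ℝ × Euc n → Fin n → Fin n → ℝ) (b : Euc n × ℝ × Euc n → ℝ)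
    (hell : UniformlyElliptic n U a b CE)
    (xst : Euc n) (hxst : xst ∈ Metric.ball x₁ r₁)
    (N : Set (Euc n)) (hNopen : IsOpen N) (hxstN : xst ∈ N)
    (φ₀ φ₁ : Euc n → ℝ)
    (hφ₀ : ContDiffOn ℝ 2 φ₀ N) (hφ₁ : ContDiffOn ℝ 2 φ₁ N)
    (hadm₀ : UAdmissibleOn n U N φ₀) (hadm₁ : UAdmissibleOn n U N φ₁)
    (hmax : IsLocalMax (fun x => (φ₁ x - φ₀ x) + δ * w x) xst)
    (hhess₁ : (hessM n φ₁ xst + CS • (1 : Matrix (Fin n) (Fin n) ℝ)).PosSemidef)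
    (hM₀ : MEval n a b φ₀ xst ≤ CE) :
    (∀ i, |Bcoef n a b φ₀ φ₁ i xst| ≤ (n : ℝ) ^ 2 * CE * (CH + 1)) ∧
    |Ccoef n a b φ₀ φ₁ xst| ≤ (n : ℝ) ^ 2 * CE * (CH + 1) ∧
    Real.sqrt (∑ i, (Bcoef n a b φ₀ φ₁ i xst) ^ 2) ≤ (n : ℝ) ^ 3 * CE * (CH + 1) := by
  have hn₁ : 1 ≤ n := by omega
  have hn₂ : (2 : ℝ) ≤ n := by exact_mod_cast hn
  have hCE₀ : 0 < CE := by linarith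
  obtain ⟨-, -, -, -, -, hA, hbd⟩ := hell
  have hN : N ∈ nhds xst := hNopen.mem_nhds hxstN
  have hc₀ : ContDiffAt ℝ 2 φ₀ xst := hφ₀.contDiffAt hN
  have hc₁ : ContDiffAt ℝ 2 φ₁ xst := hφ₁.contDiffAt hN
  have hz₀ := hadm₀ xst hxstN
  have hz₁ := hadm₁ xst hxstN
  have hnorm : r₀ < ‖xst‖ := by
    rw [Metric.mem_ball, dist_eq_norm] at hxst
    have h := norm_sub_norm_le x₁ xst
    rw [norm_sub_rev] at h
    linarith
  have hx₀ : xst ≠ 0 := norm_pos_iff.1 (hr₀.trans hnorm)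
  have hcoef : δ * α * ‖xst‖ ^ (-(α + 2)) ≤ 1 := by
    rw [le_div_iff₀ hα] at hδα
    rw [Real.rpow_neg (norm_nonneg _), ← div_eq_mul_inv, div_le_one (by positivity)]
    exact hδα.trans (Real.rpow_le_rpow hr₀.le hnorm.le (by linarith))
  have hmax' : IsLocalMax (fun x => (φ₁ x - φ₀ x) + δ * ‖x‖ ^ (-α)) xst := by
    simpa only [hw] using hmax
  have hCHnonneg : CE ^ 2 * (2 + Fintype.card (Fin n) * (CS + 1)) ≤ CH := by
    rw [hCH, Fintype.card_fin]
    have h : (2 : ℝ) + n * (CS + 1) ≤ 2 * (((n : ℝ) - 1) * (CS + 1) + 2) := by nlinarith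
    have h' := mul_le_mul_of_nonneg_left h (sq_nonneg CE)
    linarith
  have hhess : ∀ i j, |pd2 n i j φ₀ xst| ≤ CH ∧ |pd2 n i j φ₁ xst| ≤ CH := by
    refine abs_entry_le_of_elliptic (H₀ := hessM n φ₀ xst) (H₁ := hessM n φ₁ xst) hCE hCS.le
      (hA _ hz₀) ?_ hhess₁ (fun ξ => ?_) ?_ hCHnonneg (by simpa using hn₁)
    · ext i j
      simpa [hessM] using pd2_comm hc₀ j i
    · have h := hessian_quadraticForm_le_of_isLocalMax hc₀ hc₁ hα.le hδ.le hx₀ hmax'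
        (WithLp.toLp 2 ξ)
      have hsq : ‖(WithLp.toLp 2 ξ : Euc n)‖ ^ 2 = ∑ i, ξ i ^ 2 := by
        simp [EuclideanSpace.norm_sq_eq]
      have h' := mul_le_mul_of_nonneg_right hcoef (sq_nonneg ‖(WithLp.toLp 2 ξ : Euc n)‖)
      rw [one_mul, hsq] at h'
      rw [hsq] at h
      exact h.trans (add_le_add_right h' _)
    · let i : Fin n := ⟨0, by omega⟩
      have h := (abs_le.1 (hbd _ hz₀ i i i).2.2.2.2).1
      simp only [MEval] at hM₀
      simp only [hessM, Matrix.of_apply]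
      linarith
  have hzt : ∀ t ∈ Set.Icc (0 : ℝ) 1,
      (xst, phit n φ₀ φ₁ t xst, gradient (phit n φ₀ φ₁ t) xst) ∈ U := fun t ht => by
    have h₀ : (φ₀ xst, gradient φ₀ xst) ∈ {rp : ℝ × Euc n | (xst, rp.1, rp.2) ∈ U} := hz₀
    have h₁ : (φ₁ xst, gradient φ₁ xst) ∈ {rp : ℝ × Euc n | (xst, rp.1, rp.2) ∈ U} := hz₁
    have h := hfiber xst h₀ h₁ (sub_nonneg.2 ht.2) ht.1 (by ring)
    rw [gradient_phit (hc₀.differentiableAt (by simp)) (hc₁.differentiableAt (by simp))]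
    simpa [phit] using h
  have hHt : ∀ t ∈ Set.Icc (0 : ℝ) 1, ∀ i j, |pd2 n i j (phit n φ₀ φ₁ t) xst| ≤ CH := by
    intro t ht i j
    rw [pd2_phit hc₀ hc₁, abs_le]
    obtain ⟨h₀, h₁⟩ := hhess i j
    rw [abs_le] at h₀ h₁
    constructor <;> nlinarith [ht.1, ht.2]
  have hB : ∀ i, |Bcoef n a b φ₀ φ₁ i xst| ≤ (n : ℝ) ^ 2 * CE * (CH + 1) := fun i =>
    abs_integral_contraction_le hn₁ hCE₀.le (fun t ht j k => (hbd _ (hzt t ht) j k i).1) hHt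
      fun t ht => (hbd _ (hzt t ht) i i i).2.2.1
  refine ⟨hB, ?_, ?_⟩
  · let i : Fin n := ⟨0, by omega⟩
    exact abs_integral_contraction_le hn₁ hCE₀.le
      (fun t ht j k => (hbd _ (hzt t ht) j k i).2.1) hHt
      fun t ht => (hbd _ (hzt t ht) i i i).2.2.2.1
  · have hX : 0 ≤ (n : ℝ) ^ 2 * CE * (CH + 1) := (abs_nonneg _).trans (hB ⟨0, by omega⟩)
    refine Real.sqrt_le_iff.2 ⟨by nlinarith, ?_⟩
    calc ∑ i, Bcoef n a b φ₀ φ₁ i xst ^ 2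
        ≤ ∑ _i : Fin n, ((n : ℝ) ^ 2 * CE * (CH + 1)) ^ 2 :=
          Finset.sum_le_sum fun i _ => sq_le_sq.2 ((hB i).trans (le_abs_self _))
      _ = n * ((n : ℝ) ^ 2 * CE * (CH + 1)) ^ 2 := by simp
      _ ≤ (n : ℝ) ^ 2 * ((n : ℝ) ^ 2 * CE * (CH + 1)) ^ 2 := by
          gcongr
          nlinarith
      _ = ((n : ℝ) ^ 3 * CE * (CH + 1)) ^ 2 := by ring

end
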